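/- arXiv:2505.07368 — 2 statements merged into one kernel-verified Lean document; each statement's English description precedes it below -/
import Mathlib

section
/- For all real parameters ε, a₁, a₂, γ, the 6-dimensional real vector space with basis k¹, k², k³, k⁴, k⁵, k⁶, equipped with the antisymmetric bilinear bracket determined on basis elements by [k¹,k²] = γ·k³ + a₁·k⁵, [k¹,k³] = −γ·k² + a₂·k⁶, [k¹,k⁴] = −ε·k⁴, [k¹,k⁵] = k² − ε·k⁵ + γ·k⁶, [k¹,k⁶] = k³ − γ·k⁵ − ε·k⁶, [k²,k⁵] = −k⁴, [k³,k⁶] = −k⁴, and all other brackets of basis elements equal to zero, satisfies the Jacobi identity, and hence is a Lie algebra. -/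
noncomputable section

/-- The antisymmetric bilinear bracket on `ℝ⁶` (basis `k¹,…,k⁶` indexed by `0,…,5`)
determined by
`[k¹,k²] = γk³ + a₁k⁵`, `[k¹,k³] = −γk² + a₂k⁶`, `[k¹,k⁴] = −εk⁴`,
`[k¹,k⁵] = k² − εk⁵ + γk⁶`, `[k¹,k⁶] = k³ − γk⁵ − εk⁶`, `[k²,k⁵] = −k⁴`,
`[k³,k⁶] = −k⁴`, all other brackets of basis elements zero, extended bilinearly. -/
def bracket (ε a₁ a₂ γ : ℝ) (x y : Fin 6 → ℝ) : Fin 6 → ℝ :=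
  let p : Fin 6 → Fin 6 → ℝ := fun i j => x i * y j - x j * y i
  ![0,
    -γ * p 0 2 + p 0 4,
    γ * p 0 1 + p 0 5,
    -ε * p 0 3 - p 1 4 - p 2 5,
    a₁ * p 0 1 - ε * p 0 4 - γ * p 0 5,
    a₂ * p 0 2 + γ * p 0 4 - ε * p 0 5]

end

/-- the bracket is antisymmetric and satisfies the Jacobi identity,
hence defines a Lie algebra structure on `ℝ⁶`. -/
theorem bracket_jacobi (ε a₁ a₂ γ : ℝ) :
    (∀ x y : Fin 6 → ℝ, bracket ε a₁ a₂ γ x y = -bracket ε a₁ a₂ γ y x) ∧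
    (∀ x y z : Fin 6 → ℝ,
      bracket ε a₁ a₂ γ (bracket ε a₁ a₂ γ x y) z
        + bracket ε a₁ a₂ γ (bracket ε a₁ a₂ γ y z) x
        + bracket ε a₁ a₂ γ (bracket ε a₁ a₂ γ z x) y = 0) := by
  refine ⟨fun x y => ?_, fun x y z => ?_⟩
  · ext i
    fin_cases i <;> simp [bracket] <;> ring
  · ext i
    fin_cases i <;> simp [bracket] <;> ring
end

section
/- Fix real parameters ε, a₁, a₂, γ and consider on ℝ⁴ with coordinates (x₁,x₂,x₃,x₄) the vector field X = −x₂·∂_{x₂} − x₃·∂_{x₃} − 2x₄·∂_{x₄}. Then the Lie derivative of the exponential-coordinate metric satisfies L_X G_{ε,a₁,a₂,γ} = −2·G_{ε,a₁,a₂,γ} at every point of ℝ⁴; that is, X is a homothety of G_{ε,a₁,a₂,γ} with factor −2. -/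
open Real Matrix

noncomputable section

/-- Points of `ℝ⁴`, with coordinates `(x₁,x₂,x₃,x₄)` indexed by `Fin 4`. -/
abbrev V4 := Fin 4 → ℝ

/-- Partial derivative `∂_i f` of a scalar function on `ℝ⁴`. -/
noncomputable def pd (i : Fin 4) (f : V4 → ℝ) (x : V4) : ℝ :=
  fderiv ℝ f x (Pi.single i 1)

/-- The exponential-coordinate metric `G_{ε,a₁,a₂,γ}` on `ℝ⁴`. -/
noncomputable def Gexp (ε a₁ a₂ γ : ℝ) (x : V4) : Matrix (Fin 4) (Fin 4) ℝ :=
  !![(γ ^ 2 + a₁) * (x 1) ^ 2 + (γ ^ 2 + a₂) * (x 2) ^ 2 - 2 * ε * x 3, -γ * x 2, γ * x 1, 1;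
     -γ * x 2, 1, 0, 0;
     γ * x 1, 0, 1, 0;
     1, 0, 0, 0]

/-- The Lie derivative of a metric `g` along a vector field `X`:
`(L_X g)_{ab} = X^c ∂_c g_{ab} + (∂_a X^c) g_{cb} + (∂_b X^c) g_{ac}`. -/
noncomputable def lieDeriv (X : V4 → V4) (g : V4 → Matrix (Fin 4) (Fin 4) ℝ) (x : V4) :
    Matrix (Fin 4) (Fin 4) ℝ :=
  Matrix.of fun a b =>
    (∑ c, X x c * pd c (fun y => g y a b) x)
      + (∑ c, pd a (fun y => X y c) x * g x c b)
      + (∑ c, pd b (fun y => X y c) x * g x a c)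

end

lemma pd_of_hasFDerivAt {f : V4 → ℝ} {f' : V4 →L[ℝ] ℝ} {x : V4} (h : HasFDerivAt f f' x)
    (i : Fin 4) : pd i f x = f' (Pi.single i 1) := by
  rw [pd, h.fderiv]

lemma pd_const (i : Fin 4) (k : ℝ) (x : V4) : pd i (fun _ => k) x = 0 := by
  simp [pd]

lemma pd_const_mul_apply (i j : Fin 4) (k : ℝ) (x : V4) :
    pd i (fun y => k * y j) x = k * (Pi.single i 1 : V4) j := by
  rw [pd_of_hasFDerivAt ((hasFDerivAt_apply j x).const_mul k)]
  simp

lemma pd_neg_apply (i j : Fin 4) (x : V4) :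
    pd i (fun y => -y j) x = -(Pi.single i 1 : V4) j := by
  rw [pd_of_hasFDerivAt (hasFDerivAt_apply j x).fun_neg]
  simp

lemma pd_quadratic (i j k l : Fin 4) (p q r : ℝ) (x : V4) :
    pd i (fun y => p * y j ^ 2 + q * y k ^ 2 - r * y l) x =
      2 * p * x j * (Pi.single i 1 : V4) j + 2 * q * x k * (Pi.single i 1 : V4) k
        - r * (Pi.single i 1 : V4) l := by
  rw [pd_of_hasFDerivAt (((((hasFDerivAt_apply j x).pow 2).const_mul p).fun_add
    (((hasFDerivAt_apply k x).pow 2).const_mul q)).fun_sub ((hasFDerivAt_apply l x).const_mul r))]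
  simp
  ring

/-- the vector field `X = −x₂∂_{x₂} − x₃∂_{x₃} − 2x₄∂_{x₄}` is a
homothety of `G_{ε,a₁,a₂,γ}` with factor `−2`: `L_X G = −2·G`. -/
theorem homothety_Gexp (ε a₁ a₂ γ : ℝ) (x : V4) :
    lieDeriv (fun y => ![0, -y 1, -y 2, -2 * y 3]) (Gexp ε a₁ a₂ γ) x
      = (-2 : ℝ) • Gexp ε a₁ a₂ γ x := by
  ext a b
  fin_cases a <;> fin_cases b <;>
    simp [lieDeriv, Gexp, Fin.sum_univ_four, pd_const, pd_const_mul_apply, pd_neg_apply,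
      pd_quadratic, -neg_mul, Pi.single_apply] <;>
    ring
end
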